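/- For all integers 1 ≤ k ≤ n and every positive divisor d of gcd(k,n), the number of diagrams λ ∈ Y_{k,n} satisfying σ^{n/d}(λ) = λ equals the binomial coefficient C(n/d, k/d). -/

import Mathlib

/-- A Young diagram inscribed in a `k × (n-k)` rectangle: a weakly decreasing
sequence `λ₁ ≥ … ≥ λ_k` (0-indexed) with all entries `≤ n - k`. -/
def IsDiagram (k n : ℕ) (lam : Fin k → ℕ) : Prop :=
  (∀ i j : Fin k, i ≤ j → lam j ≤ lam i) ∧ ∀ i, lam i ≤ n - k

/-- The cyclic step map `σ` on diagrams: add one box to every row if the first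
row is shorter than `n - k`, otherwise drop the first row and append a zero row. -/
def cyc (k n : ℕ) (lam : Fin k → ℕ) : Fin k → ℕ :=
  if ∀ i, lam i < n - k then fun i => lam i + 1
  else fun i => if h : (i : ℕ) + 1 < k then lam ⟨(i : ℕ) + 1, h⟩ else 0

/-- The orbit length `o(λ)`: the least positive `t` with `σ^[t] λ = λ`. -/
noncomputable def orbLen (k n : ℕ) (lam : Fin k → ℕ) : ℕ :=
  sInf {t | 0 < t ∧ (cyc k n)^[t] lam = lam}

/-- Upper triangular diagram: `k·λᵢ ≤ (n-k)(k-i)` for all `i` (1-indexed). -/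
def IsUpper (k n : ℕ) (lam : Fin k → ℕ) : Prop :=
  ∀ i : Fin k, k * lam i ≤ (n - k) * (k - 1 - (i : ℕ))

/-- Lexicographic (non-strict) comparison of diagrams. -/
def lexLE {k : ℕ} (lam mu : Fin k → ℕ) : Prop :=
  lam = mu ∨ ∃ t : Fin k, (∀ i, i < t → lam i = mu i) ∧ lam t < mu t

/-- Minimal upper triangular diagram: upper triangular and lexicographically
smallest among the upper triangular diagrams in its `σ`-orbit. -/
def IsMinUpper (k n : ℕ) (lam : Fin k → ℕ) : Prop :=
  IsUpper k n lam ∧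
    ∀ t : ℕ, IsUpper k n ((cyc k n)^[t] lam) → lexLE lam ((cyc k n)^[t] lam)

/-- The binary word of a diagram: position `j` (0-indexed) carries the symbol `0`
(encoded as `false`) iff `j = λ_{k-i} + i` for some `0 ≤ i ≤ k-1` (0-indexed). -/
def word (k n : ℕ) (lam : Fin k → ℕ) (j : Fin n) : Bool :=
  !decide (∃ i : Fin k, (j : ℕ) = lam i.rev + (i : ℕ))

/-- A binary word of length `n` with exactly `k` zeros (`false` encodes `0`). -/
def IsWord (k n : ℕ) (w : Fin n → Bool) : Prop :=
  (Finset.univ.filter fun j => w j = false).card = k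

/-- Rotation of a binary word: `r(w)_j = w_{j+1}`, indices mod `n`. -/
def rot {n : ℕ} (w : Fin n → Bool) (j : Fin n) : Bool :=
  w ⟨((j : ℕ) + 1) % n, Nat.mod_lt _ j.pos⟩

/-- The diagram `θ_{k,km} = ((k-1)(m-1), (k-2)(m-1), …, (m-1), 0)`. -/
def theta (k m : ℕ) : Fin k → ℕ := fun i => (k - 1 - (i : ℕ)) * (m - 1)

/-- `N_{k,n}`: the number of diagrams in `Y_{k,n}` with full orbit `o(λ) = n`. -/
noncomputable def NN (k n : ℕ) : ℕ :=
  {lam : Fin k → ℕ | IsDiagram k n lam ∧ orbLen k n lam = n}.ncard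

/-- The residues mod `n` of the shifted rows `λᵢ + (k - i)` (1-indexed) of a diagram. -/
def residues (k n : ℕ) (lam : Fin k → ℕ) : Finset (ZMod n) :=
  Finset.univ.image fun i : Fin k => ((lam i + i.rev : ℕ) : ZMod n)

theorem IsDiagram.cyc {k n : ℕ} {lam : Fin k → ℕ} (h : IsDiagram k n lam) :
    IsDiagram k n (cyc k n lam) := by
  obtain ⟨hanti, hle⟩ := h
  unfold _root_.cyc
  split_ifs with hlt
  · exact ⟨fun i j hij => Nat.succ_le_succ (hanti i j hij), hlt⟩
  · refine ⟨fun i j hij => ?_, fun i => ?_⟩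
    · have hij' : (i : ℕ) ≤ j := hij
      dsimp only
      split_ifs with hj hi
      · exact hanti _ _ (Fin.le_def.2 (Nat.succ_le_succ hij'))
      · omega
      · exact Nat.zero_le _
      · exact le_rfl
    · dsimp only
      split_ifs
      · exact hle _
      · exact Nat.zero_le _

theorem residues_cyc {k n : ℕ} (hk : 1 ≤ k) (hkn : k ≤ n) {lam : Fin k → ℕ}
    (h : IsDiagram k n lam) :
    residues k n (cyc k n lam) = (residues k n lam).image (· + 1) := by
  obtain ⟨hanti, hle⟩ := h
  unfold residues cyc
  rw [Finset.image_image]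
  split_ifs with hlt
  · congr 1
    funext i
    simp only [Function.comp]
    push_cast
    ring
  · have h0 : lam ⟨0, hk⟩ = n - k := by
      push Not at hlt
      obtain ⟨i, hi⟩ := hlt
      have := hanti ⟨0, hk⟩ i (Fin.le_def.2 (Nat.zero_le _))
      have := hle ⟨0, hk⟩
      omega
    have wrap : ((lam ⟨0, hk⟩ + (Fin.rev ⟨0, hk⟩ : Fin k) : ℕ) : ZMod n) + 1 = 0 := by
      rw [h0, Fin.val_rev, ← Nat.cast_add_one,
        show n - k + (k - (0 + 1)) + 1 = n by omega, ZMod.natCast_self]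
    have shift (i : ℕ) (hi : i + 1 < k) :
        ((lam ⟨i + 1, hi⟩ + (Fin.rev ⟨i, by omega⟩ : Fin k) : ℕ) : ZMod n) =
          ((lam ⟨i + 1, hi⟩ + (Fin.rev ⟨i + 1, hi⟩ : Fin k) : ℕ) : ZMod n) + 1 := by
      rw [← Nat.cast_add_one]
      congr 1
      simp only [Fin.val_rev]
      omega
    ext x
    simp only [Finset.mem_image, Finset.mem_univ, true_and, Function.comp]
    constructor
    · rintro ⟨⟨i, hik⟩, rfl⟩
      by_cases hi : i + 1 < k
      · exact ⟨⟨i + 1, hi⟩, by simp only [dif_pos hi]; exact (shift i hi).symm⟩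
      · refine ⟨⟨0, hk⟩, wrap.trans ?_⟩
        simp only [dif_neg hi, Fin.val_rev]
        rw [show 0 + (k - (i + 1)) = 0 by omega, Nat.cast_zero]
    · rintro ⟨⟨i, hik⟩, rfl⟩
      cases i with
      | zero =>
        refine ⟨⟨k - 1, by omega⟩, Eq.trans ?_ wrap.symm⟩
        simp only [dif_neg (show ¬ (k - 1 + 1 < k) by omega), Fin.val_rev]
        rw [show 0 + (k - (k - 1 + 1)) = 0 by omega, Nat.cast_zero]
      | succ i =>
        exact ⟨⟨i, by omega⟩, by simp only [dif_pos hik]; exact shift i hik⟩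

theorem IsDiagram.iterate_cyc {k n : ℕ} {lam : Fin k → ℕ} (h : IsDiagram k n lam) (t : ℕ) :
    IsDiagram k n ((_root_.cyc k n)^[t] lam) := by
  induction t with
  | zero => exact h
  | succ t ih => rw [Function.iterate_succ_apply']; exact ih.cyc

theorem residues_iterate_cyc {k n : ℕ} (hk : 1 ≤ k) (hkn : k ≤ n) {lam : Fin k → ℕ}
    (h : IsDiagram k n lam) (t : ℕ) :
    residues k n ((cyc k n)^[t] lam) = (residues k n lam).image (· + (t : ZMod n)) := by
  induction t with
  | zero => simp
  | succ t ih =>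
    rw [Function.iterate_succ_apply', residues_cyc hk hkn (h.iterate_cyc t), ih,
      Finset.image_image]
    congr 1
    funext x
    simp [add_assoc]

theorem IsDiagram.strictMono {k n : ℕ} {lam : Fin k → ℕ} (h : IsDiagram k n lam) :
    StrictMono fun i : Fin k => lam i.rev + i := fun i j hij => by
  have := h.1 j.rev i.rev (Fin.rev_le_rev.2 hij.le)
  have : (i : ℕ) < j := hij
  dsimp only
  omega

theorem IsDiagram.add_rev_lt {k n : ℕ} (hkn : k ≤ n) {lam : Fin k → ℕ} (h : IsDiagram k n lam)
    (i : Fin k) : lam i + i.rev < n := by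
  have := h.2 i
  have := i.rev.isLt
  omega

theorem coe_residues (k n : ℕ) (lam : Fin k → ℕ) :
    (residues k n lam : Set (ZMod n)) =
      (fun a : ℕ => (a : ZMod n)) '' Set.range fun i : Fin k => lam i.rev + i := by
  ext x
  simp only [residues, Finset.coe_image, Finset.coe_univ, Set.image_univ, Set.mem_range,
    Set.mem_image, exists_exists_eq_and]
  exact ⟨fun ⟨i, hi⟩ => ⟨i.rev, by rwa [Fin.rev_rev]⟩,
    fun ⟨i, hi⟩ => ⟨i.rev, by rwa [Fin.rev_rev]⟩⟩

theorem injOn_natCast_zmod (n : ℕ) : Set.InjOn (fun a : ℕ => (a : ZMod n)) (Set.Iio n) :=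
  fun a ha b hb hab => by
    have := (ZMod.natCast_eq_natCast_iff' a b n).1 hab
    rwa [Nat.mod_eq_of_lt ha, Nat.mod_eq_of_lt hb] at this

theorem residues_injOn {k n : ℕ} (hkn : k ≤ n) :
    Set.InjOn (residues k n) {lam | IsDiagram k n lam} := by
  intro lam hlam mu hmu h
  have hsub {nu : Fin k → ℕ} (hnu : IsDiagram k n nu) :
      Set.range (fun i : Fin k => nu i.rev + i) ⊆ Set.Iio n := by
    rintro _ ⟨i, rfl⟩
    simpa using hnu.add_rev_lt hkn i.rev
  have hr := congrArg (fun s : Finset (ZMod n) => (s : Set (ZMod n))) h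
  simp only [coe_residues] at hr
  have := (hlam.strictMono.range_inj hmu.strictMono).1
    (((injOn_natCast_zmod n).image_eq_image_iff (hsub hlam) (hsub hmu)).1 hr)
  funext i
  simpa using congrFun this i.rev

theorem card_residues {k n : ℕ} (hkn : k ≤ n) {lam : Fin k → ℕ} (h : IsDiagram k n lam) :
    (residues k n lam).card = k := by
  rw [residues, Finset.card_image_of_injective, Finset.card_univ, Fintype.card_fin]
  intro i j hij
  have := injOn_natCast_zmod n (h.add_rev_lt hkn i) (h.add_rev_lt hkn j) hij
  exact Fin.rev_injective (h.strictMono.injective (by simpa using this))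

theorem StrictMono.add_sub_le_fin {k : ℕ} {f : Fin k → ℕ} (hf : StrictMono f) {i j : Fin k}
    (hij : i ≤ j) : f i + (j - i : ℕ) ≤ f j := by
  obtain ⟨j, hj⟩ := j
  induction j with
  | zero =>
    obtain rfl : i = ⟨0, hj⟩ := Fin.ext (Nat.le_zero.1 hij)
    simp
  | succ j ih =>
    rcases hij.eq_or_lt with rfl | hlt
    · simp
    · have hij' : (i : ℕ) ≤ j := Nat.lt_succ_iff.1 hlt
      have h₁ := ih (by omega) hij'
      have h₂ := hf (show (⟨j, by omega⟩ : Fin k) < ⟨j + 1, hj⟩ from Nat.lt_succ_self j)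
      dsimp only at h₁ ⊢
      omega

theorem exists_residues_eq {k n : ℕ} [NeZero n] {T : Finset (ZMod n)} (hT : T.card = k) :
    ∃ lam, IsDiagram k n lam ∧ residues k n lam = T := by
  have hcard : (T.image ZMod.val).card = k := by
    rw [Finset.card_image_of_injective _ (ZMod.val_injective n), hT]
  set e := (T.image ZMod.val).orderEmbOfFin hcard with he
  have hmono : StrictMono e := e.strictMono
  have hlt (i : Fin k) : e i < n := by
    obtain ⟨x, -, hx⟩ := Finset.mem_image.1 (Finset.orderEmbOfFin_mem _ hcard i)
    rw [he, ← hx]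
    exact ZMod.val_lt x
  have hge (i : Fin k) : (i : ℕ) ≤ e i := by
    have := hmono.add_sub_le_fin (show (⟨0, i.pos⟩ : Fin k) ≤ i from Nat.zero_le _)
    dsimp only at this
    omega
  refine ⟨fun i => e i.rev - i.rev, ⟨fun i j hij => ?_, fun i => ?_⟩, ?_⟩
  · have h₁ := hmono.add_sub_le_fin (Fin.rev_le_rev.2 hij)
    have h₂ : (j.rev : ℕ) ≤ i.rev := Fin.rev_le_rev.2 hij
    have := hge j.rev
    dsimp only
    omega
  · have hpos := i.pos
    have h₁ := hmono.add_sub_le_fin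
      (show i.rev ≤ ⟨k - 1, by omega⟩ from Nat.le_sub_one_of_lt i.rev.isLt)
    have := hlt ⟨k - 1, by omega⟩
    have := i.rev.isLt
    have := hge i.rev
    dsimp only at h₁ ⊢
    omega
  · apply Finset.coe_injective
    rw [coe_residues]
    have : (fun i : Fin k => e i.rev.rev - (i.rev.rev : ℕ) + i) = e := by
      funext i
      rw [Fin.rev_rev]
      exact Nat.sub_add_cancel (hge i)
    rw [this, he, Finset.range_orderEmbOfFin, Finset.coe_image, Set.image_image]
    simp

theorem residues_image_fixed {k n : ℕ} (hk : 1 ≤ k) (hkn : k ≤ n) (t : ℕ) :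
    residues k n '' {lam | IsDiagram k n lam ∧ (cyc k n)^[t] lam = lam} =
      {T | T.card = k ∧ T.image (· + (t : ZMod n)) = T} := by
  have : NeZero n := ⟨by omega⟩
  ext T
  constructor
  · rintro ⟨lam, ⟨h, hfix⟩, rfl⟩
    exact ⟨card_residues hkn h, by rw [← residues_iterate_cyc hk hkn h, hfix]⟩
  · rintro ⟨hT, hfix⟩
    obtain ⟨lam, h, rfl⟩ := exists_residues_eq hT
    rw [← residues_iterate_cyc hk hkn h] at hfix
    exact ⟨lam, ⟨h, residues_injOn hkn (h.iterate_cyc t) h hfix⟩, rfl⟩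

theorem card_filter_castHom_mem {m d : ℕ} [NeZero m] [NeZero (m * d)] (U : Finset (ZMod m)) :
    (Finset.univ.filter fun x : ZMod (m * d) =>
      ZMod.castHom (Dvd.intro d rfl) (ZMod m) x ∈ U).card = d * U.card := by
  set π := ZMod.castHom (Dvd.intro d rfl : m ∣ m * d) (ZMod m) with hπ
  have hsurj : Function.Surjective π := ZMod.castHom_surjective _
  have hfib (u : ZMod m) : (Finset.univ.filter fun x => π x = u).card =
      (Finset.univ.filter fun x => π x = 0).card := by
    obtain ⟨y, rfl⟩ := hsurj u
    refine Finset.card_bij' (fun x _ => x - y) (fun x _ => x + y) ?_ ?_ ?_ ?_ <;>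
      simp +contextual
  have hcount (V : Finset (ZMod m)) : (Finset.univ.filter fun x => π x ∈ V).card =
      V.card * (Finset.univ.filter fun x => π x = 0).card := by
    rw [Finset.card_eq_sum_card_fiberwise (t := V) (f := π) (by intro x; simp),
      Finset.sum_congr rfl (g := fun _ => (Finset.univ.filter fun x => π x = 0).card),
      Finset.sum_const, smul_eq_mul]
    intro u hu
    rw [← hfib u, Finset.filter_filter]
    congr 1
    ext x
    simp only [Finset.mem_filter, Finset.mem_univ, true_and, and_iff_right_iff_imp]
    rintro rfl
    exact hu
  have htotal := hcount Finset.univ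
  simp only [Finset.mem_univ, Finset.filter_true, Finset.card_univ, ZMod.card] at htotal
  rw [hcount, ← Nat.eq_of_mul_eq_mul_left (NeZero.pos m) htotal, mul_comm]

theorem filter_castHom_mem_image_eq_self {m d : ℕ} [NeZero (m * d)] {T : Finset (ZMod (m * d))}
    (hT : T.image (· + (m : ZMod (m * d))) = T) :
    (Finset.univ.filter fun x : ZMod (m * d) => ZMod.castHom (Dvd.intro d rfl) (ZMod m) x ∈
      T.image (ZMod.castHom (Dvd.intro d rfl) (ZMod m))) = T := by
  have hadd (j : ℕ) {x : ZMod (m * d)} (hx : x ∈ T) : x + (j * m : ℕ) ∈ T := by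
    induction j with
    | zero => simpa using hx
    | succ j ih =>
      rw [← hT]
      refine Finset.mem_image.2 ⟨_, ih, ?_⟩
      push_cast
      ring
  ext y
  simp only [Finset.mem_filter, Finset.mem_univ, true_and, Finset.mem_image]
  refine ⟨fun ⟨x, hx, hxy⟩ => ?_, fun hy => ⟨y, hy, rfl⟩⟩
  have hz : ((y - x).val : ZMod m) = 0 := by
    rw [← map_natCast (ZMod.castHom (Dvd.intro d rfl : m ∣ m * d) (ZMod m)),
      ZMod.natCast_zmod_val, map_sub, hxy, sub_self]
  obtain ⟨j, hj⟩ := (ZMod.natCast_eq_zero_iff _ _).1 hz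
  have := hadd j hx
  rwa [mul_comm j, ← hj, ZMod.natCast_zmod_val, add_sub_cancel] at this

/-- The `d * l`-subsets of `ZMod (m * d)` invariant under translation by `m` are the preimages of
the `l`-subsets of `ZMod m`. -/
theorem ncard_translation_invariant {m d l : ℕ} (hm : 0 < m) (hd : 0 < d) :
    {T : Finset (ZMod (m * d)) | T.card = d * l ∧ T.image (· + (m : ZMod (m * d))) = T}.ncard =
      m.choose l := by
  have : NeZero m := ⟨hm.ne'⟩
  have : NeZero (m * d) := ⟨(Nat.mul_pos hm hd).ne'⟩
  set π := ZMod.castHom (Dvd.intro d rfl : m ∣ m * d) (ZMod m) with hπ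
  have hsurj : Function.Surjective π := ZMod.castHom_surjective _
  let pre : Finset (ZMod m) → Finset (ZMod (m * d)) := fun U => Finset.univ.filter fun x => π x ∈ U
  have hinj : Function.Injective pre := by
    intro U V h
    ext u
    obtain ⟨x, rfl⟩ := hsurj u
    simpa [pre] using Finset.ext_iff.1 h x
  have himage : {T : Finset (ZMod (m * d)) | T.card = d * l ∧
      T.image (· + (m : ZMod (m * d))) = T} =
      pre '' (Finset.powersetCard l (Finset.univ : Finset (ZMod m)) : Set (Finset (ZMod m))) := by
    ext T
    simp only [Set.mem_ofPred_eq, Set.mem_image, Finset.mem_coe, Finset.mem_powersetCard_univ]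
    constructor
    · rintro ⟨hcard, hfix⟩
      have hpre : pre (T.image π) = T := filter_castHom_mem_image_eq_self hfix
      refine ⟨T.image π, Nat.eq_of_mul_eq_mul_left hd ?_, hpre⟩
      rw [← hcard, ← card_filter_castHom_mem (T.image π)]
      exact congrArg Finset.card hpre
    · rintro ⟨U, rfl, rfl⟩
      refine ⟨card_filter_castHom_mem U, ?_⟩
      ext x
      simp only [pre, Finset.mem_image, Finset.mem_filter, Finset.mem_univ, true_and]
      constructor
      · rintro ⟨y, hy, rfl⟩
        simpa using hy
      · exact fun hx => ⟨x - m, by simpa using hx, by simp⟩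
  rw [himage, hinj.injOn.ncard_image, Set.ncard_coe_finset, Finset.card_powersetCard,
    Finset.card_univ, ZMod.card]

/-- for every positive divisor `d` of `gcd(k,n)`, the number of
diagrams `λ ∈ Y_{k,n}` fixed by `σ^{n/d}` equals `C(n/d, k/d)`. -/
theorem card_fixed_by_iterate (k n d : ℕ) (hk : 1 ≤ k) (hkn : k ≤ n)
    (hd0 : 0 < d) (hd : d ∣ Nat.gcd k n) :
    {lam : Fin k → ℕ | IsDiagram k n lam ∧ (cyc k n)^[n / d] lam = lam}.ncard =
      Nat.choose (n / d) (k / d) := by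
  obtain ⟨l, rfl⟩ := hd.trans (Nat.gcd_dvd_left k n)
  obtain ⟨m, rfl⟩ := hd.trans (Nat.gcd_dvd_right (d * l) n)
  rw [mul_comm d m] at hkn ⊢
  rw [Nat.mul_div_cancel _ hd0, Nat.mul_div_cancel_left _ hd0,
    ← ((residues_injOn hkn).mono fun _ h => h.1).ncard_image,
    residues_image_fixed hk hkn, ncard_translation_invariant _ hd0]
  exact Nat.pos_of_mul_pos_right (hk.trans hkn)
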